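/- For all nonnegative integers m_1, m_2, the submodule L(m_1, m_2) is nonzero and irreducible: every nonzero ℂ-subspace of L(m_1, m_2) that is invariant under all twelve derivations e_1,…,e_6, f_1,…,f_6 equals L(m_1, m_2). -/

import Mathlib

open MvPolynomial
open scoped Fin.NatCast

noncomputable section

abbrev A : Type := MvPolynomial (Fin 27) ℂ

/-- the variable `x_i` (1-based indexing). -/
def xv (i : ℕ) : A := X ((i - 1 : ℕ) : Fin 27)

/-- the partial derivative `∂_i` (1-based indexing) as a linear operator. -/
def pdE (i : Fin 27) : Module.End ℂ A := (pderiv i).toLinearMap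

/-- the operator `x_a ∂_b` (1-based indexing). -/
def md (a b : ℕ) : Module.End ℂ A :=
  (LinearMap.mulLeft ℂ (xv a)) ∘ₗ pdE ((b - 1 : ℕ) : Fin 27)

/-- the actions `e_1, …, e_6` of the simple positive root vectors of `E₆`. -/
def eOp : ℕ → Module.End ℂ A
  | 1 => -md 1 2 + md 11 14 + md 15 17 + md 16 19 + md 18 21 + md 20 23
  | 2 => -md 4 6 - md 5 7 - md 8 10 + md 18 20 + md 21 23 + md 22 24
  | 3 => -md 2 3 + md 9 11 + md 12 15 + md 13 16 + md 21 22 + md 23 24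
  | 4 => -md 3 4 - md 7 9 - md 10 12 - md 16 18 - md 19 21 + md 24 25
  | 5 => -md 4 5 - md 6 7 - md 12 13 - md 15 16 - md 17 19 + md 25 26
  | 6 => -md 5 8 - md 7 10 - md 9 12 - md 11 15 - md 14 17 + md 26 27
  | _ => 0

/-- the actions `f_1, …, f_6` of the simple negative root vectors of `E₆`. -/
def fOp : ℕ → Module.End ℂ A
  | 1 => md 2 1 - md 14 11 - md 17 15 - md 19 16 - md 21 18 - md 23 20
  | 2 => md 6 4 + md 7 5 + md 10 8 - md 20 18 - md 23 21 - md 24 22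
  | 3 => md 3 2 - md 11 9 - md 15 12 - md 16 13 - md 22 21 - md 24 23
  | 4 => md 4 3 + md 9 7 + md 12 10 + md 18 16 + md 21 19 - md 25 24
  | 5 => md 5 4 + md 7 6 + md 13 12 + md 16 15 + md 19 17 - md 26 25
  | 6 => md 8 5 + md 10 7 + md 12 9 + md 15 11 + md 17 14 - md 27 26
  | _ => 0

/-- the involution of `{0,…,26}` fixing `12, 13, 14` (0-based version of ι). -/
def iotaF : Fin 27 → Fin 27 := fun j =>
  if j.val = 12 ∨ j.val = 13 ∨ j.val = 14 then j else ⟨26 - j.val, by omega⟩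

/-- the algebra automorphism τ of `A`. -/
def tau : A →ₐ[ℂ] A := rename iotaF

def z1 : A := xv 1 * xv 14 + xv 2 * xv 11 + xv 3 * xv 9 - xv 4 * xv 7 + xv 5 * xv 6
def z2 : A := fOp 6 z1
def z3 : A := fOp 5 z2
def z4 : A := fOp 4 z3
def z5 : A := fOp 3 z4
def z6 : A := fOp 2 z4
def z7 : A := fOp 3 z6
def z8 : A := fOp 1 z5
def z9 : A := fOp 4 z7
def z10 : A := fOp 1 z7
def z11 : A := -(fOp 5 z9)
def z12 : A := fOp 4 z10
def z13 : A := fOp 3 z12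
def z14 : A := -(fOp 6 z11)
def z15 : A := -(fOp 5 z12)

/-- the quadratic polynomials `ζ_1, …, ζ_27` (1-based indexing). -/
def zeta : ℕ → A
  | 1 => z1 | 2 => z2 | 3 => z3 | 4 => z4 | 5 => z5 | 6 => z6 | 7 => z7
  | 8 => z8 | 9 => z9 | 10 => z10 | 11 => z11 | 12 => z12 | 13 => z13
  | 14 => z14 | 15 => z15
  | 16 => tau z12 | 17 => tau z11 | 18 => tau z10 | 19 => tau z9
  | 20 => tau z8 | 21 => tau z7 | 22 => tau z6 | 23 => tau z5
  | 24 => tau z4 | 25 => tau z3 | 26 => tau z2 | 27 => tau z1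
  | _ => 0

/-- the involution ι of `{1,…,27}` fixing `13, 14, 15`. -/
def iotaN (i : ℕ) : ℕ := if i = 13 ∨ i = 14 ∨ i = 15 then i else 28 - i

/-- the signs ε_i. -/
def eps (i : ℕ) : ℂ :=
  if i = 9 ∨ i = 11 ∨ i = 12 ∨ i = 13 ∨ i = 14 ∨ i = 15 ∨ i = 16 ∨ i = 17 ∨ i = 19
  then -1 else 1

/-- the `E₆`-invariant cubic polynomial η (Dickson's trilinear form). -/
def eta : A := ∑ i ∈ Finset.Icc 1 27, eps i • (xv i * zeta (iotaN i))

lemma pderiv_swap (i j : Fin 27) (p : A) :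
    pderiv i (pderiv j p) = pderiv j (pderiv i p) := by
  induction p using MvPolynomial.induction_on with
  | C a => simp
  | add p q hp hq => simp [hp, hq]
  | mul_X p k ih =>
      have h1 : pderiv i ((pderiv j) (X k) : A) = 0 := by
        rcases eq_or_ne j k with h | h
        · subst h; simp [pderiv_X_self]
        · simp [pderiv_X_of_ne (Ne.symm h)]
      have h2 : pderiv j ((pderiv i) (X k) : A) = 0 := by
        rcases eq_or_ne i k with h | h
        · subst h; simp [pderiv_X_self]
        · simp [pderiv_X_of_ne (Ne.symm h)]
      simp only [pderiv_mul, map_add, ih, h1, h2]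
      ring

lemma pdE_comm (i j : Fin 27) : Commute (pdE i) (pdE j) := by
  refine LinearMap.ext fun p => ?_
  simpa [pdE, Module.End.mul_apply] using pderiv_swap i j p

/-- `Im(g)`: the constant-coefficient differential operator obtained from `g` by
replacing each variable `x_i` by `∂_i`. -/
def Imo (g : A) : Module.End ℂ A :=
  ∑ d ∈ g.support, g.coeff d •
    Finset.univ.noncommProd (fun i : Fin 27 => pdE i ^ d i)
      (fun i _ j _ _ => (pdE_comm i j).pow_pow _ _)

/-- the invariant operator `D = Im(η)`. -/
def Dop : Module.End ℂ A := Imo eta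

/-- the Euler operator `D₁`. -/
def D1 : Module.End ℂ A := ∑ i : Fin 27, (LinearMap.mulLeft ℂ (X i : A)) ∘ₗ pdE i

/-- the invariant operator `D₂ = Σ ζ_i · Im(ζ_i)`. -/
def D2 : Module.End ℂ A :=
  ∑ i ∈ Finset.Icc 1 27, (LinearMap.mulLeft ℂ (zeta i)) ∘ₗ Imo (zeta i)


/-- `L(m₁, m₂)`: the smallest submodule of `A` (invariant under all twelve
derivations) containing `x₁^{m₁} ζ₁^{m₂}`. -/
def Lmod (m1 m2 : ℕ) : Submodule ℂ A :=
  sInf {W : Submodule ℂ A | xv 1 ^ m1 * zeta 1 ^ m2 ∈ W ∧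
    ∀ i : ℕ, 1 ≤ i → i ≤ 6 → ∀ p ∈ W, eOp i p ∈ W ∧ fOp i p ∈ W}

section HighestWeight

variable {V ι : Type*} [AddCommGroup V] [Module ℂ V]

/-- The smallest subspace containing `v` and stable under all operators `f i`. -/
def genBy (f : ι → Module.End ℂ V) (v : V) : Submodule ℂ V :=
  sInf {W | v ∈ W ∧ ∀ i, ∀ p ∈ W, f i p ∈ W}

lemma self_mem_genBy (f : ι → Module.End ℂ V) (v : V) : v ∈ genBy f v :=
  Submodule.mem_sInf.2 fun _ hW => hW.1

lemma map_mem_genBy (f : ι → Module.End ℂ V) {v p : V} (i : ι) (hp : p ∈ genBy f v) :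
    f i p ∈ genBy f v :=
  Submodule.mem_sInf.2 fun W hW => hW.2 i p (Submodule.mem_sInf.1 hp W hW)

lemma genBy_le {f : ι → Module.End ℂ V} {v : V} {P : Submodule ℂ V} (hv : v ∈ P)
    (hf : ∀ i, ∀ p ∈ genBy f v, p ∈ P → f i p ∈ P) : genBy f v ≤ P := by
  have h : genBy f v ≤ genBy f v ⊓ P := sInf_le
    ⟨⟨self_mem_genBy f v, hv⟩, fun i _ hp => ⟨map_mem_genBy f i hp.1, hf i _ hp.1 hp.2⟩⟩
  exact h.trans inf_le_right

lemma genBy_le_span_sup (f : ι → Module.End ℂ V) (v : V) :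
    genBy f v ≤ ℂ ∙ v ⊔ ⨆ i, (genBy f v).map (f i) :=
  genBy_le (Submodule.mem_sup_left (Submodule.mem_span_singleton_self v)) fun i _ hp _ =>
    Submodule.mem_sup_right (Submodule.mem_iSup_of_mem i (Submodule.mem_map_of_mem hp))

lemma weight_mem_genBy {f h : ι → Module.End ℂ V} {v : V}
    (hhv : ∀ i, ∃ c : ℂ, h i v = c • v)
    (hhf : ∀ i j, ∃ c : ℂ, ∀ p, h i (f j p) = f j (h i p) + c • f j p)
    (i : ι) {p : V} (hp : p ∈ genBy f v) : h i p ∈ genBy f v := by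
  refine genBy_le (P := (genBy f v).comap (h i)) ?_ ?_ hp
  · obtain ⟨c, hc⟩ := hhv i
    simpa [hc] using Submodule.smul_mem _ c (self_mem_genBy f v)
  · intro j p hp hhp
    obtain ⟨c, hc⟩ := hhf i j
    rw [Submodule.mem_comap, hc]
    exact add_mem (map_mem_genBy f j hhp) (Submodule.smul_mem _ c (map_mem_genBy f j hp))

lemma raising_mem_genBy [DecidableEq ι] {e f h : ι → Module.End ℂ V} {v : V}
    (hev : ∀ i, e i v = 0)
    (hhv : ∀ i, ∃ c : ℂ, h i v = c • v)
    (hef : ∀ i j p, e i (f j p) = f j (e i p) + if i = j then h i p else 0)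
    (hhf : ∀ i j, ∃ c : ℂ, ∀ p, h i (f j p) = f j (h i p) + c • f j p)
    (i : ι) {p : V} (hp : p ∈ genBy f v) : e i p ∈ genBy f v := by
  refine genBy_le (P := (genBy f v).comap (e i)) ?_ ?_ hp
  · simp [hev i]
  · intro j p hp hep
    rw [Submodule.mem_comap, hef]
    refine add_mem (map_mem_genBy f j hep) ?_
    split_ifs
    · exact weight_mem_genBy hhv hhf i hp
    · exact zero_mem _

/-- Orthogonal projection onto a finite-dimensional subspace, for a positive definite form. -/
lemma exists_mem_orthogonal_sub (cd : InnerProductSpace.Core ℂ V) (W : Submodule ℂ V)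
    [FiniteDimensional ℂ W] (v : V) :
    ∃ w ∈ W, ∀ y ∈ W, cd.inner y (v - w) = 0 := by
  let _ := cd.toNormedAddCommGroup
  let _ : InnerProductSpace ℂ V := InnerProductSpace.ofCore cd.toCore
  exact ⟨W.starProjection v, W.starProjection_apply_mem v, fun y hy =>
    (Submodule.mem_orthogonal W _).1 (W.sub_starProjection_mem_orthogonal v) y hy⟩

/-- A subspace stable under `e` and `f` inside a highest weight module carrying a contravariant
positive definite form is zero or everything. -/
theorem eq_genBy_of_contravariant (cd : InnerProductSpace.Core ℂ V)
    {e f : ι → Module.End ℂ V} {v : V}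
    (hadj : ∀ i x y, cd.inner (f i x) y = -cd.inner x (e i y))
    (hev : ∀ i, e i v = 0) {W : Submodule ℂ V} [FiniteDimensional ℂ W]
    (hW : W ≤ genBy f v) (hW0 : W ≠ ⊥)
    (heW : ∀ i, ∀ p ∈ W, e i p ∈ W) (hfW : ∀ i, ∀ p ∈ W, f i p ∈ W) : W = genBy f v := by
  obtain ⟨w, hw, hort⟩ := exists_mem_orthogonal_sub cd W v
  let _ := cd.toNormedAddCommGroup
  let _ : InnerProductSpace ℂ V := InnerProductSpace.ofCore cd.toCore
  replace hadj : ∀ i x y, inner ℂ (f i x) y = -inner ℂ x (e i y) := hadj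
  replace hort : ∀ y ∈ W, inner ℂ y (v - w) = 0 := hort
  have hew : ∀ i, e i w = 0 := by
    intro i
    have h := hort _ (hfW i _ (heW i w hw))
    rw [hadj, map_sub, hev, zero_sub, inner_neg_right, neg_neg] at h
    exact inner_self_eq_zero.1 h
  have hperp : ∀ u, (∀ i, e i u = 0) → ∀ n ∈ ⨆ i, (genBy f v).map (f i), inner ℂ n u = 0 := by
    intro u hu n hn
    have : (⨆ i, (genBy f v).map (f i)) ≤ (ℂ ∙ u)ᗮ := by
      refine iSup_le fun i => ?_
      rintro _ ⟨y, -, rfl⟩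
      rw [Submodule.mem_orthogonal_singleton_iff_inner_left, hadj, hu, inner_zero_right, neg_zero]
    exact Submodule.mem_orthogonal_singleton_iff_inner_left.1 (this hn)
  obtain ⟨_, hc, n, hn, hcn⟩ := Submodule.mem_sup.1 (genBy_le_span_sup f v (hW hw))
  obtain ⟨c, rfl⟩ := Submodule.mem_span_singleton.1 hc
  have hn0 : n = 0 := by
    have h := hperp w hew n hn
    rw [← hcn, inner_add_right, inner_smul_right, hperp v hev n hn, mul_zero, zero_add] at h
    exact inner_self_eq_zero.1 h
  rw [hn0, add_zero] at hcn
  refine le_antisymm hW ?_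
  by_cases hc0 : c = 0
  · have hw0 : w = 0 := by rw [← hcn, hc0, zero_smul]
    refine absurd ?_ hW0
    rw [eq_bot_iff]
    intro u hu
    have hle : genBy f v ≤ Wᗮ := by
      refine sInf_le ⟨?_, fun i p hp => ?_⟩
      · exact (Submodule.mem_orthogonal _ _).2 fun y hy => by simpa [hw0] using hort y hy
      · refine (Submodule.mem_orthogonal' _ _).2 fun y hy => ?_
        rw [hadj, (Submodule.mem_orthogonal' _ _).1 hp _ (heW i y hy), neg_zero]
    exact inner_self_eq_zero.1 ((Submodule.mem_orthogonal _ _).1 (hle (hW hu)) u hu)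
  · refine sInf_le ⟨?_, hfW⟩
    have : v = c⁻¹ • w := by rw [← hcn, smul_smul, inv_mul_cancel₀ hc0, one_smul]
    rw [this]
    exact W.smul_mem _ hw

end HighestWeight

section Fischer

variable {σ : Type*}

/-- The Fischer (apolar) sesquilinear form: monomials are orthogonal, and `x^d` has square
norm `d!`. -/
def fischer (p q : MvPolynomial σ ℂ) : ℂ :=
  ∑ d ∈ p.support, (d.prod fun _ n => (n.factorial : ℂ)) * (star (p.coeff d) * q.coeff d)

lemma fischer_eq_sum_of_subset {p : MvPolynomial σ ℂ} {s : Finset (σ →₀ ℕ)} (h : p.support ⊆ s)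
    (q : MvPolynomial σ ℂ) : fischer p q =
      ∑ d ∈ s, (d.prod fun _ n => (n.factorial : ℂ)) * (star (p.coeff d) * q.coeff d) :=
  Finset.sum_subset h fun d _ hd => by simp [notMem_support_iff.1 hd]

lemma fischer_add_left (p p' q : MvPolynomial σ ℂ) :
    fischer (p + p') q = fischer p q + fischer p' q := by
  classical
  rw [fischer_eq_sum_of_subset (support_add (p := p) (q := p')),
    fischer_eq_sum_of_subset (Finset.subset_union_left (s₂ := p'.support)),
    fischer_eq_sum_of_subset (Finset.subset_union_right (s₁ := p.support)),
    ← Finset.sum_add_distrib]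
  simp [mul_add, add_mul]

lemma fischer_smul_left (c : ℂ) (p q : MvPolynomial σ ℂ) :
    fischer (c • p) q = star c * fischer p q := by
  rw [fischer_eq_sum_of_subset (support_smul (a := c) (f := p)), fischer, Finset.mul_sum]
  refine Finset.sum_congr rfl fun d _ => ?_
  simp only [coeff_smul, smul_eq_mul, star_mul']
  ring

lemma fischer_star (p q : MvPolynomial σ ℂ) : star (fischer q p) = fischer p q := by
  classical
  rw [fischer_eq_sum_of_subset (p := p) (Finset.subset_union_left (s₂ := q.support)),
    fischer_eq_sum_of_subset (p := q) (Finset.subset_union_right (s₁ := p.support)), star_sum]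
  refine Finset.sum_congr rfl fun d _ => ?_
  simp only [Finsupp.prod, star_mul', star_prod, star_natCast, star_star]
  ring

lemma fischer_monomial_left (d : σ →₀ ℕ) (c : ℂ) (q : MvPolynomial σ ℂ) :
    fischer (monomial d c) q =
      (d.prod fun _ n => (n.factorial : ℂ)) * (star c * q.coeff d) := by
  classical
  rw [fischer_eq_sum_of_subset support_monomial_subset]
  simp

lemma fischer_self (p : MvPolynomial σ ℂ) : fischer p p =
    ((∑ d ∈ p.support, (d.prod fun _ n => (n.factorial : ℝ)) * ‖p.coeff d‖ ^ 2 : ℝ) : ℂ) := by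
  simp only [fischer, Finsupp.prod]
  push_cast
  refine Finset.sum_congr rfl fun d _ => ?_
  rw [← Complex.conj_mul']
  rfl

/-- The Fischer form as a positive definite inner product. -/
@[reducible] def fischerCore : InnerProductSpace.Core ℂ (MvPolynomial σ ℂ) where
  inner := fischer
  conj_inner_symm p q := fischer_star p q
  re_inner_nonneg p := by
    rw [fischer_self, RCLike.re_eq_complex_re, Complex.ofReal_re]
    exact Finset.sum_nonneg fun d _ => mul_nonneg
      (Finset.prod_nonneg fun _ _ => Nat.cast_nonneg _) (sq_nonneg _)
  add_left := fischer_add_left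
  smul_left p q c := fischer_smul_left c p q
  definite p hp := by
    rw [fischer_self, Complex.ofReal_eq_zero, Finset.sum_eq_zero_iff_of_nonneg fun d _ =>
      mul_nonneg (Finset.prod_nonneg fun _ _ => Nat.cast_nonneg _) (sq_nonneg _)] at hp
    ext d
    by_contra hd
    have h := hp d (mem_support_iff.2 hd)
    rw [mul_eq_zero] at h
    rcases h with h | h
    · obtain ⟨i, -, hi⟩ := Finset.prod_eq_zero_iff.1 h
      exact Nat.factorial_ne_zero (d i) (Nat.cast_eq_zero.1 hi)
    · exact hd (by simpa using h)

lemma prod_factorial_add_single (d : σ →₀ ℕ) (a : σ) :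
    ((d + Finsupp.single a 1).prod fun _ n => (n.factorial : ℂ)) =
      (d a + 1) * d.prod fun _ n => (n.factorial : ℂ) := by
  classical
  rw [← Finsupp.mul_prod_erase' (d + Finsupp.single a 1) a _ (by simp),
    ← Finsupp.mul_prod_erase' d a _ (by simp), Finsupp.erase_add, Finsupp.erase_single, add_zero]
  simp [Nat.factorial_succ, mul_assoc]

lemma fischer_X_mul_left (a : σ) (p q : MvPolynomial σ ℂ) :
    fischer (X a * p) q = fischer p (pderiv a q) := by
  induction p using MvPolynomial.induction_on' with
  | monomial d c =>
    rw [mul_comm, X, monomial_mul, mul_one, fischer_monomial_left, fischer_monomial_left,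
      coeff_pderiv, prod_factorial_add_single]
    ring
  | add p q hp hq => rw [mul_add, fischer_add_left, fischer_add_left, hp, hq]

lemma fischer_pderiv_left (a : σ) (p q : MvPolynomial σ ℂ) :
    fischer (pderiv a p) q = fischer p (X a * q) := by
  rw [← fischer_star, ← fischer_X_mul_left, fischer_star]

lemma fischer_neg_left (p q : MvPolynomial σ ℂ) : fischer (-p) q = -fischer p q := by
  simpa using fischer_smul_left (-1) p q

lemma fischer_add_right (p q q' : MvPolynomial σ ℂ) :
    fischer p (q + q') = fischer p q + fischer p q' := by
  rw [← fischer_star, fischer_add_left, star_add, fischer_star, fischer_star]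

lemma fischer_neg_right (p q : MvPolynomial σ ℂ) : fischer p (-q) = -fischer p q := by
  rw [← fischer_star, fischer_neg_left, star_neg, fischer_star]

end Fischer


section LinearDerivation

/-- The derivation `∑ c x_a ∂_b` (1-based indexing) over the triples `(c, a, b)` of a list. -/
def listDer (l : List (ℤ × ℕ × ℕ)) : Derivation ℂ A A :=
  (l.map fun t => t.1 • (xv t.2.1 • pderiv ((t.2.2 - 1 : ℕ) : Fin 27))).sum

lemma listDer_nil : listDer [] = 0 := rfl

lemma listDer_cons (t : ℤ × ℕ × ℕ) (l : List (ℤ × ℕ × ℕ)) (p : A) :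
    listDer (t :: l) p = t.1 • md t.2.1 t.2.2 p + listDer l p := by
  simp [listDer, md, pdE, mul_left_comm]

/-- The (0-based) variable to which `listDer l` maps `X b`, up to a coefficient. -/
def target (l : List (ℤ × ℕ × ℕ)) (b : Fin 27) : Fin 27 :=
  match l.find? fun t => ((t.2.2 - 1 : ℕ) : Fin 27) = b with
  | some t => ((t.2.1 - 1 : ℕ) : Fin 27)
  | none => 0

/-- The coefficient with which `listDer l` acts on `X b`. -/
def scalar (l : List (ℤ × ℕ × ℕ)) (b : Fin 27) : ℤ :=
  match l.find? fun t => ((t.2.2 - 1 : ℕ) : Fin 27) = b with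
  | some t => t.1
  | none => 0

lemma md_X (a b : ℕ) (k : Fin 27) :
    md a b (X k) = if ((b - 1 : ℕ) : Fin 27) = k then xv a else 0 := by
  by_cases h : ((b - 1 : ℕ) : Fin 27) = k
  · simp [md, pdE, h]
  · simp [md, pdE, h, pderiv_X_of_ne (Ne.symm h)]

lemma listDer_X {l : List (ℤ × ℕ × ℕ)}
    (hl : (l.map fun t => ((t.2.2 - 1 : ℕ) : Fin 27)).Nodup) (b : Fin 27) :
    listDer l (X b) = scalar l b • (X (target l b) : A) := by
  induction l with
  | nil => simp [listDer_nil, scalar]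
  | cons t l ih =>
    rw [List.map_cons, List.nodup_cons] at hl
    rw [listDer_cons, md_X, ih hl.2]
    by_cases h : ((t.2.2 - 1 : ℕ) : Fin 27) = b
    · have hnone : l.find? (fun t => ((t.2.2 - 1 : ℕ) : Fin 27) = b) = none := by
        rw [List.find?_eq_none]
        intro u hu hub
        exact hl.1 (List.mem_map.2 ⟨u, hu, by simpa [h] using hub⟩)
      simp [scalar, target, h, hnone, xv]
    · simp [scalar, target, h]

lemma md_mem_restrictTotalDegree (a b n : ℕ) {p : A} (hp : p ∈ restrictTotalDegree (Fin 27) ℂ n) :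
    md a b p ∈ restrictTotalDegree (Fin 27) ℂ n := by
  suffices h : restrictTotalDegree (Fin 27) ℂ n ≤
      (restrictTotalDegree (Fin 27) ℂ n).comap (md a b) from h hp
  conv_lhs => rw [restrictTotalDegree, restrictSupport_eq_span]
  rw [Submodule.span_le]
  rintro _ ⟨d, hd, rfl⟩
  rw [SetLike.mem_coe, Submodule.mem_comap]
  simp only [md, pdE, xv, LinearMap.comp_apply, Derivation.coeFn_coe, pderiv_monomial,
    LinearMap.mulLeft_apply, X, monomial_mul]
  rw [restrictTotalDegree, monomial_mem_restrictSupport]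
  set k : Fin 27 := ((b - 1 : ℕ) : Fin 27)
  rcases Nat.eq_zero_or_pos (d k) with h | h
  · right; simp [h]
  · left
    have hk : d = (d - Finsupp.single k 1) + Finsupp.single k 1 := by
      rw [tsub_add_cancel_of_le]
      exact Finsupp.single_le_iff.2 h
    simp only [Set.mem_ofPred_eq] at hd ⊢
    have hsum : ∀ d : Fin 27 →₀ ℕ, (d.sum fun _ e => e) = d.degree := fun d => rfl
    rw [hsum] at hd ⊢
    rw [hk] at hd
    simp only [map_add, Finsupp.degree_single] at hd ⊢
    omega

end LinearDerivation

section E6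

/-- The terms of `e_1, …, e_6`. -/
def eTerms : Fin 6 → List (ℤ × ℕ × ℕ) := ![
  [(-1, 1, 2), (1, 11, 14), (1, 15, 17), (1, 16, 19), (1, 18, 21), (1, 20, 23)],
  [(-1, 4, 6), (-1, 5, 7), (-1, 8, 10), (1, 18, 20), (1, 21, 23), (1, 22, 24)],
  [(-1, 2, 3), (1, 9, 11), (1, 12, 15), (1, 13, 16), (1, 21, 22), (1, 23, 24)],
  [(-1, 3, 4), (-1, 7, 9), (-1, 10, 12), (-1, 16, 18), (-1, 19, 21), (1, 24, 25)],
  [(-1, 4, 5), (-1, 6, 7), (-1, 12, 13), (-1, 15, 16), (-1, 17, 19), (1, 25, 26)],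
  [(-1, 5, 8), (-1, 7, 10), (-1, 9, 12), (-1, 11, 15), (-1, 14, 17), (1, 26, 27)]]

/-- The terms of `f_1, …, f_6`, obtained from those of `e_1, …, e_6` by `x_a ∂_b ↦ -x_b ∂_a`. -/
def fTerms (i : Fin 6) : List (ℤ × ℕ × ℕ) := (eTerms i).map fun t => (-t.1, t.2.2, t.2.1)

lemma eOp_apply (i : Fin 6) (p : A) : eOp (i + 1) p = listDer (eTerms i) p := by
  fin_cases i <;>
    simp [eOp, eTerms, listDer_cons, listDer_nil, sub_eq_add_neg, add_assoc]

lemma fOp_apply (i : Fin 6) (p : A) : fOp (i + 1) p = listDer (fTerms i) p := by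
  fin_cases i <;>
    simp [fOp, eTerms, fTerms, listDer_cons, listDer_nil, sub_eq_add_neg, add_assoc]

lemma listDer_eTerms_X (i : Fin 6) (b : Fin 27) :
    listDer (eTerms i) (X b) = scalar (eTerms i) b • (X (target (eTerms i) b) : A) :=
  listDer_X (by revert i; decide) b

lemma listDer_fTerms_X (i : Fin 6) (b : Fin 27) :
    listDer (fTerms i) (X b) = scalar (fTerms i) b • (X (target (fTerms i) b) : A) :=
  listDer_X (by revert i; decide) b

/-- The Cartan element `[e_i, f_i]`. -/
def cartanDer (i : Fin 6) : Derivation ℂ A A := ⁅listDer (eTerms i), listDer (fTerms i)⁆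

/-- The coefficient with which `⁅e_i, f_i⁆` acts on `X b`. -/
def weight (i : Fin 6) (b : Fin 27) : ℤ :=
  scalar (fTerms i) b * scalar (eTerms i) (target (fTerms i) b) -
    scalar (eTerms i) b * scalar (fTerms i) (target (eTerms i) b)

lemma target_target (i : Fin 6) (b : Fin 27) :
    (scalar (fTerms i) b * scalar (eTerms i) (target (fTerms i) b) = 0 ∨
      target (eTerms i) (target (fTerms i) b) = b) ∧
    (scalar (eTerms i) b * scalar (fTerms i) (target (eTerms i) b) = 0 ∨
      target (fTerms i) (target (eTerms i) b) = b) := by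
  revert i b
  decide +kernel

lemma scalar_target_comm (i j : Fin 6) (hij : i ≠ j) (b : Fin 27) :
    scalar (fTerms j) b * scalar (eTerms i) (target (fTerms j) b) =
      scalar (eTerms i) b * scalar (fTerms j) (target (eTerms i) b) ∧
    (scalar (fTerms j) b * scalar (eTerms i) (target (fTerms j) b) = 0 ∨
      target (eTerms i) (target (fTerms j) b) = target (fTerms j) (target (eTerms i) b)) := by
  revert i j b
  decide +kernel

lemma weight_target (i j : Fin 6) (b : Fin 27) : scalar (fTerms j) b = 0 ∨
    weight i (target (fTerms j) b) = weight i b + CartanMatrix.E₆ i j := by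
  revert i j b
  decide +kernel

lemma cartanDer_X (i : Fin 6) (b : Fin 27) : cartanDer i (X b) = weight i b • (X b : A) := by
  rw [cartanDer, Derivation.commutator_apply, listDer_eTerms_X, listDer_fTerms_X, map_zsmul,
    map_zsmul, listDer_eTerms_X, listDer_fTerms_X, smul_smul, smul_smul, weight, sub_smul]
  obtain ⟨h₁ | h₁, h₂ | h₂⟩ := target_target i b <;> simp [h₁, h₂]

lemma listDer_eTerms_fTerms (i j : Fin 6) (p : A) :
    listDer (eTerms i) (listDer (fTerms j) p) =
      listDer (fTerms j) (listDer (eTerms i) p) + if i = j then cartanDer i p else 0 := by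
  rw [add_comm, ← sub_eq_iff_eq_add]
  split_ifs with hij
  · rw [← hij, cartanDer, Derivation.commutator_apply]
  · have h : ⁅listDer (eTerms i), listDer (fTerms j)⁆ = 0 := by
      refine derivation_ext fun b => ?_
      rw [Derivation.commutator_apply, listDer_eTerms_X, listDer_fTerms_X, map_zsmul,
        map_zsmul, listDer_eTerms_X, listDer_fTerms_X, smul_smul, smul_smul]
      obtain ⟨h₁, h₂⟩ := scalar_target_comm i j hij b
      rw [← h₁]
      rcases h₂ with h₂ | h₂ <;> simp [h₂]
    rw [← Derivation.commutator_apply, h, Derivation.zero_apply]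

lemma cartanDer_fTerms (i j : Fin 6) (p : A) :
    cartanDer i (listDer (fTerms j) p) =
      listDer (fTerms j) (cartanDer i p) + CartanMatrix.E₆ i j • listDer (fTerms j) p := by
  rw [add_comm, ← sub_eq_iff_eq_add, ← Derivation.commutator_apply, ← Derivation.smul_apply]
  congr 1
  refine derivation_ext fun b => ?_
  rw [Derivation.commutator_apply, cartanDer_X, listDer_fTerms_X, map_zsmul, map_zsmul,
    Derivation.smul_apply, listDer_fTerms_X, cartanDer_X, smul_smul, smul_smul, smul_smul,
    ← sub_smul]
  rcases weight_target i j b with h | h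
  · simp [h]
  · rw [h]; congr 1; ring

lemma xv_ne_zero (a : ℕ) : xv a ≠ 0 := X_ne_zero _

lemma z1_eq : z1 = X 0 * X 13 + X 1 * X 10 + X 2 * X 8 - X 3 * X 6 + X 4 * X 5 := rfl

lemma z1_ne_zero : z1 ≠ 0 := by
  intro h
  have := congrArg (eval fun i => if i = 0 ∨ i = 13 then (1 : ℂ) else 0) h
  simp [z1_eq] at this

lemma listDer_eTerms_xv_one (i : Fin 6) : listDer (eTerms i) (xv 1) = 0 := by
  have h : scalar (eTerms i) 0 = 0 := by revert i; decide
  exact (listDer_eTerms_X i 0).trans (by rw [h, zero_smul])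

lemma listDer_eTerms_z1 (i : Fin 6) : listDer (eTerms i) z1 = 0 := by
  rw [← eOp_apply]
  fin_cases i <;> simp [eOp, md, pdE, z1, xv, pderiv_X] <;> ring

lemma cartanDer_z1 (i : Fin 6) : cartanDer i z1 = (weight i 0 + weight i 13) • z1 := by
  have h : weight i 1 + weight i 10 = weight i 0 + weight i 13 ∧
      weight i 2 + weight i 8 = weight i 0 + weight i 13 ∧
      weight i 3 + weight i 6 = weight i 0 + weight i 13 ∧
      weight i 4 + weight i 5 = weight i 0 + weight i 13 := by
    revert i; decide +kernel
  have hmul (a b : Fin 27) :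
      cartanDer i (X a * X b : A) = (weight i a + weight i b) • (X a * X b : A) := by
    rw [Derivation.leibniz, cartanDer_X, cartanDer_X, add_smul]
    simp only [smul_eq_mul, mul_smul_comm]
    rw [mul_comm (X b) (X a), add_comm]
  simp only [z1_eq, map_add, map_sub, hmul, h.1, h.2.1, h.2.2.1, h.2.2.2, smul_add, smul_sub]

lemma Derivation.pow_of_eigen {D : Derivation ℂ A A} {p : A} {c : ℂ} (h : D p = c • p) (n : ℕ) :
    D (p ^ n) = (n * c) • p ^ n := by
  rcases n with _ | n
  · simp
  · rw [Derivation.leibniz_pow, h]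
    simp only [Nat.add_sub_cancel, smul_eq_mul, mul_smul_comm, ← pow_succ, mul_smul]
    rw [← Nat.cast_smul_eq_nsmul ℂ]

lemma Derivation.mul_of_eigen {D : Derivation ℂ A A} {p q : A} {c d : ℂ} (hp : D p = c • p)
    (hq : D q = d • q) : D (p * q) = (c + d) • (p * q) := by
  rw [Derivation.leibniz, hp, hq, add_smul, smul_eq_mul, smul_eq_mul, mul_smul_comm,
    mul_smul_comm, mul_comm q p, add_comm]

lemma listDer_eTerms_highest (m1 m2 : ℕ) (i : Fin 6) :
    listDer (eTerms i) (xv 1 ^ m1 * zeta 1 ^ m2) = 0 := by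
  rw [zeta, Derivation.leibniz, Derivation.leibniz_pow, Derivation.leibniz_pow,
    listDer_eTerms_xv_one, listDer_eTerms_z1]
  simp

lemma cartanDer_highest (m1 m2 : ℕ) (i : Fin 6) :
    ∃ c : ℂ, cartanDer i (xv 1 ^ m1 * zeta 1 ^ m2) = c • (xv 1 ^ m1 * zeta 1 ^ m2) := by
  have h₁ : cartanDer i (xv 1) = (weight i 0 : ℂ) • xv 1 := by
    rw [Int.cast_smul_eq_zsmul]
    exact cartanDer_X i 0
  have h₂ : cartanDer i (zeta 1) = ((weight i 0 + weight i 13 : ℤ) : ℂ) • zeta 1 := by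
    rw [Int.cast_smul_eq_zsmul]
    exact cartanDer_z1 i
  exact ⟨_, Derivation.mul_of_eigen (Derivation.pow_of_eigen h₁ m1)
    (Derivation.pow_of_eigen h₂ m2)⟩

lemma fischer_md_left (a b : ℕ) (p q : A) : fischer (md a b p) q = fischer p (md b a q) := by
  simp only [md, pdE, xv, LinearMap.comp_apply, Derivation.coeFn_coe, LinearMap.mulLeft_apply,
    fischer_X_mul_left, fischer_pderiv_left]

lemma fischer_fOp_left (i : Fin 6) (p q : A) :
    fischer (fOp (i + 1) p) q = -fischer p (eOp (i + 1) q) := by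
  fin_cases i <;>
    simp [fOp, eOp, sub_eq_add_neg, fischer_add_left, fischer_add_right, fischer_neg_left,
      fischer_neg_right, fischer_md_left] <;> ring

lemma fOp_mem_restrictTotalDegree (i : Fin 6) (n : ℕ) {p : A}
    (hp : p ∈ restrictTotalDegree (Fin 27) ℂ n) :
    fOp (i + 1) p ∈ restrictTotalDegree (Fin 27) ℂ n := by
  rw [fOp_apply]
  induction fTerms i with
  | nil => simp [listDer_nil]
  | cons t l ih =>
    rw [listDer_cons]
    exact add_mem (zsmul_mem (md_mem_restrictTotalDegree _ _ _ hp) _) ih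

lemma Lmod_eq_genBy (m1 m2 : ℕ) :
    Lmod m1 m2 = genBy (fun i : Fin 6 => fOp (i + 1)) (xv 1 ^ m1 * zeta 1 ^ m2) := by
  apply le_antisymm
  · refine sInf_le ⟨self_mem_genBy _ _, fun k hk hk' p hp => ?_⟩
    obtain ⟨i, rfl⟩ : ∃ i : Fin 6, k = i + 1 := ⟨⟨k - 1, by omega⟩, by simp; omega⟩
    refine ⟨raising_mem_genBy (e := fun i : Fin 6 => eOp (i + 1))
      (h := fun i => (cartanDer i).toLinearMap) ?_ (cartanDer_highest m1 m2) ?_ ?_ i hp,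
      map_mem_genBy (fun i : Fin 6 => fOp (i + 1)) i hp⟩
    · intro i
      rw [eOp_apply, listDer_eTerms_highest]
    · intro i j p
      simp only [eOp_apply, fOp_apply]
      exact listDer_eTerms_fTerms i j p
    · intro i j
      refine ⟨CartanMatrix.E₆ i j, fun p => ?_⟩
      rw [Int.cast_smul_eq_zsmul]
      simp only [fOp_apply]
      exact cartanDer_fTerms i j p
  · exact le_sInf fun W hW => sInf_le
      ⟨hW.1, fun i p hp => (hW.2 (i + 1) (by omega) (by omega) p hp).2⟩

end E6

/-- each `L(m₁, m₂)` is a nonzero irreducible submodule. -/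
theorem stmt19 (m1 m2 : ℕ) :
    Lmod m1 m2 ≠ ⊥ ∧
    ∀ W : Submodule ℂ A, W ≤ Lmod m1 m2 → W ≠ ⊥ →
      (∀ i : ℕ, 1 ≤ i → i ≤ 6 → ∀ p ∈ W, eOp i p ∈ W ∧ fOp i p ∈ W) →
      W = Lmod m1 m2 := by
  rw [Lmod_eq_genBy]
  set v : A := xv 1 ^ m1 * zeta 1 ^ m2
  have hv : v ≠ 0 := mul_ne_zero (pow_ne_zero _ (xv_ne_zero 1)) (pow_ne_zero _ z1_ne_zero)
  refine ⟨fun h => hv ((Submodule.mem_bot ℂ).1 (h ▸ self_mem_genBy _ v)), fun W hW hW0 hst => ?_⟩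
  have hdeg : genBy (fun i : Fin 6 => fOp (i + 1)) v ≤
      restrictTotalDegree (Fin 27) ℂ v.totalDegree :=
    genBy_le ((mem_restrictTotalDegree _ _ _).2 le_rfl) fun i _ _ hp =>
      fOp_mem_restrictTotalDegree i _ hp
  have : FiniteDimensional ℂ W := Submodule.finiteDimensional_of_le (hW.trans hdeg)
  refine eq_genBy_of_contravariant fischerCore (e := fun i : Fin 6 => eOp (i + 1))
    fischer_fOp_left (fun i => ?_) hW hW0 (fun i p hp => (hst _ (by omega) (by omega) p hp).1)
    (fun i p hp => (hst _ (by omega) (by omega) p hp).2)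
  rw [eOp_apply, listDer_eTerms_highest]

end
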